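/- For N even, N ≥ 7 (so consider N ≥ 8 even), the second Terracini locus of the Spinor variety S_N^+ equals (the Hilbert-scheme points supported on) pairs of pure spinors at Hamming distance ≤ 2: two tangent spaces T_{[a]}S_N^+ and T_{[b]}S_N^+ intersect nontrivially if and only if d([a],[b]) ≤ 2. -/

import Mathlib

/- Formalization of a statement about spinor varieties (Galgano, arXiv:2302.05295). -/

noncomputable section
open CliffordAlgebra

/-- The model for the maximal isotropic subspace `E`. -/
abbrev Evec (N : ℕ) := Fin N → ℂ

/-- The model for `V = E ⊕ E^∨`: a pair `(e, f)` represents `∑ eᵢ • eᵢ + ∑ fᵢ • fᵢ`. -/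
abbrev Vsp (N : ℕ) := (Fin N → ℂ) × (Fin N → ℂ)

/-- The exterior algebra `⋀ E` hosting the (sums of half-) spin representations. -/
abbrev ExtE (N : ℕ) := ExteriorAlgebra ℂ (Evec N)

/-- `b ↦ (a ↦ ∑ aᵢ bᵢ)`, identifying `E` with its dual. -/
def toDualMap (N : ℕ) : Evec N →ₗ[ℂ] Module.Dual ℂ (Evec N) where
  toFun b := ∑ i, b i • LinearMap.proj i
  map_add' x y := by simp [add_smul, Finset.sum_add_distrib]
  map_smul' c x := by simp [smul_smul, Finset.smul_sum]

/-- Clifford multiplication on the spinor module `⋀E` by an element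
`v = (e, f) ∈ V = E ⊕ E^∨`: wedge by `e` plus contraction by `f`; bundled as a
linear map in `v`, for a fixed spinor `x`.  `psi x v = v ⋅ x`. -/
def psi {N : ℕ} (x : ExtE N) : Vsp N →ₗ[ℂ] ExtE N :=
  (LinearMap.mulRight ℂ x).comp ((ExteriorAlgebra.ι ℂ).comp (LinearMap.fst ℂ _ _)) +
  ((CliffordAlgebra.contractLeft (Q := (0 : QuadraticForm ℂ (Evec N)))).flip x).comp
    ((toDualMap N).comp (LinearMap.snd ℂ _ _))

/-- The even part `⋀^{ev} E` of the exterior algebra (one half-spin representation). -/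
def evenPart (N : ℕ) : Submodule ℂ (ExtE N) :=
  CliffordAlgebra.evenOdd (0 : QuadraticForm ℂ (Evec N)) 0

/-- The odd part `⋀^{od} E` of the exterior algebra (the other half-spin representation). -/
def oddPart (N : ℕ) : Submodule ℂ (ExtE N) :=
  CliffordAlgebra.evenOdd (0 : QuadraticForm ℂ (Evec N)) 1

/-- A (representative of a) pure spinor of the even half-spin representation:
a nonzero even spinor whose isotropic annihilator `H_a = ker ψ_a` is maximal,
of dimension `N`. -/
def purespinor {N : ℕ} (a : ExtE N) : Prop :=
  a ≠ 0 ∧ a ∈ evenPart N ∧ Module.finrank ℂ (LinearMap.ker (psi a)) = N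

/-- The spinor variety `S_N^+`, as a set of points of the projective space
`ℙ(⋀^{ev}E) ⊆ ℙ(⋀E)`. -/
def SpinorVariety (N : ℕ) : Set (Projectivization ℂ (ExtE N)) :=
  {p | ∃ (a : ExtE N) (h : a ≠ 0), purespinor a ∧ p = Projectivization.mk ℂ a h}

/-- The projective line through `p` and `q` is contained in `X`. -/
def lineIn {K V : Type*} [DivisionRing K] [AddCommGroup V] [Module K V]
    (X : Set (Projectivization K V)) (p q : Projectivization K V) : Prop :=
  ∀ r : Projectivization K V, r.submodule ≤ p.submodule ⊔ q.submodule → r ∈ X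

/-- There is a chain of `r` lines inside `X` connecting `p` to `q`. -/
def chainDist {K V : Type*} [DivisionRing K] [AddCommGroup V] [Module K V]
    (X : Set (Projectivization K V)) (p q : Projectivization K V) (r : ℕ) : Prop :=
  ∃ c : ℕ → Projectivization K V, c 0 = p ∧ c r = q ∧ (∀ i ≤ r, c i ∈ X) ∧
    ∀ i < r, lineIn X (c i) (c (i + 1))

/-- The Hamming distance on `X`: the minimal number of lines inside `X` needed to
connect `p` to `q`. -/
def hdist {K V : Type*} [DivisionRing K] [AddCommGroup V] [Module K V]
    (X : Set (Projectivization K V)) (p q : Projectivization K V) : ℕ :=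
  sInf {r | chainDist X p q r}

/-- The (affine cone over the) embedded tangent space to the spinor variety at a pure
spinor `a`: the span of `a` together with all second-order Clifford translates
`v ⋅ (w ⋅ a)` of `a`. -/
def tangentSpace {N : ℕ} (a : ExtE N) : Submodule ℂ (ExtE N) :=
  Submodule.span ℂ ({a} ∪ {x : ExtE N | ∃ v w : Vsp N, x = psi (psi a w) v})

/-- Contraction of spinors with `f ∈ E^∨`. -/
def contract {N : ℕ} : Evec N →ₗ[ℂ] Module.End ℂ (ExtE N) :=
  (CliffordAlgebra.contractLeft (Q := (0 : QuadraticForm ℂ (Evec N)))).comp (toDualMap N)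

/-- Clifford multiplication by `v`, as an endomorphism of the spinor module `⋀E`. -/
def cliff {N : ℕ} : Vsp N →ₗ[ℂ] Module.End ℂ (ExtE N) :=
  ((LinearMap.mul ℂ (ExtE N)).comp (ExteriorAlgebra.ι ℂ)).comp (LinearMap.fst ℂ _ _) +
    contract.comp (LinearMap.snd ℂ _ _)

lemma cliff_apply {N : ℕ} (v : Vsp N) (x : ExtE N) :
    cliff v x = ExteriorAlgebra.ι ℂ v.1 * x + contract v.2 x := rfl

lemma mem_ker_psi {N : ℕ} {x : ExtE N} {v : Vsp N} :
    v ∈ LinearMap.ker (psi x) ↔ cliff v x = 0 := Iff.rfl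

/-- The polarization of the quadratic form `(e, f) ↦ ∑ eᵢ fᵢ` on `V = E ⊕ E^∨`. -/
def polarForm {N : ℕ} : Vsp N →ₗ[ℂ] Vsp N →ₗ[ℂ] ℂ :=
  LinearMap.mk₂ ℂ (fun v w => v.1 ⬝ᵥ w.2 + v.2 ⬝ᵥ w.1)
    (fun v v' w => by simp; ring) (fun c v w => by simp; ring)
    (fun v w w' => by simp; ring) (fun c v w => by simp; ring)

lemma polarForm_apply {N : ℕ} (v w : Vsp N) :
    polarForm v w = v.1 ⬝ᵥ w.2 + v.2 ⬝ᵥ w.1 := rfl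

lemma polarForm_comm {N : ℕ} (v w : Vsp N) : polarForm v w = polarForm w v := by
  simp [polarForm_apply, dotProduct_comm, add_comm]

lemma polarForm_eq_zero {N : ℕ} {v : Vsp N} (h : ∀ w, polarForm v w = 0) : v = 0 := by
  ext i
  · simpa [polarForm_apply] using h (0, Pi.single i 1)
  · simpa [polarForm_apply] using h (Pi.single i 1, 0)

lemma toDualMap_apply {N : ℕ} (f e : Evec N) : toDualMap N f e = f ⬝ᵥ e := by
  simp [toDualMap, dotProduct]

lemma contract_ι_mul {N : ℕ} (f e : Evec N) (x : ExtE N) :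
    contract f (ExteriorAlgebra.ι ℂ e * x) =
      (f ⬝ᵥ e) • x - ExteriorAlgebra.ι ℂ e * contract f x := by
  rw [← toDualMap_apply]
  exact CliffordAlgebra.contractLeft_ι_mul (Q := 0) (d := toDualMap N f) e x

lemma contract_comm {N : ℕ} (f f' : Evec N) (x : ExtE N) :
    contract f (contract f' x) = -contract f' (contract f x) :=
  CliffordAlgebra.contractLeft_comm _ _ _

lemma ι_mul_comm {N : ℕ} (e e' : Evec N) (x : ExtE N) :
    ExteriorAlgebra.ι ℂ e * (ExteriorAlgebra.ι ℂ e' * x) =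
      -(ExteriorAlgebra.ι ℂ e' * (ExteriorAlgebra.ι ℂ e * x)) := by
  rw [← mul_assoc, ← mul_assoc, ← neg_mul]
  congr 1
  exact eq_neg_of_add_eq_zero_left (ExteriorAlgebra.ι_add_mul_swap e e')

lemma cliff_add_swap {N : ℕ} (v w : Vsp N) (x : ExtE N) :
    cliff v (cliff w x) + cliff w (cliff v x) = polarForm v w • x := by
  simp only [cliff_apply, map_add, contract_ι_mul]
  rw [ι_mul_comm v.1 w.1 x, contract_comm v.2 w.2, polarForm_apply, dotProduct_comm v.1, add_smul]
  abel

lemma cliff_comm {N : ℕ} (v w : Vsp N) (x : ExtE N) :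
    cliff v (cliff w x) = polarForm v w • x - cliff w (cliff v x) :=
  eq_sub_of_add_eq (cliff_add_swap v w x)

lemma ι_mul_mem_evenOdd {N : ℕ} (e : Evec N) {i : ZMod 2} {x : ExtE N}
    (hx : x ∈ evenOdd (0 : QuadraticForm ℂ (Evec N)) i) :
    ExteriorAlgebra.ι ℂ e * x ∈ evenOdd (0 : QuadraticForm ℂ (Evec N)) (i + 1) := by
  rw [add_comm i]
  exact evenOdd_mul_le _ _ _ (Submodule.mul_mem_mul (ι_mem_evenOdd_one _ e) hx)

lemma contract_mem_evenOdd {N : ℕ} (f : Evec N) {i : ZMod 2} {x : ExtE N}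
    (hx : x ∈ evenOdd (0 : QuadraticForm ℂ (Evec N)) i) :
    contract f x ∈ evenOdd (0 : QuadraticForm ℂ (Evec N)) (i + 1) := by
  have key : ∀ (n : ℕ) (y : ExtE N),
      y ∈ LinearMap.range (CliffordAlgebra.ι (0 : QuadraticForm ℂ (Evec N))) ^ n →
      contract f y ∈ evenOdd (0 : QuadraticForm ℂ (Evec N)) (n + 1) := by
    intro n y hy
    induction hy using Submodule.pow_induction_on_left' with
    | algebraMap r =>
      convert zero_mem (evenOdd (0 : QuadraticForm ℂ (Evec N)) _)
      exact CliffordAlgebra.contractLeft_algebraMap (d := toDualMap N f) _ r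
    | add x y i hx hy ihx ihy => rw [map_add]; exact add_mem ihx ihy
    | mem_mul m hm i x hx ih =>
      obtain ⟨e, rfl⟩ := hm
      have h2 : ((i.succ : ℕ) : ZMod 2) + 1 = i := by
        push_cast
        rw [add_assoc, CharTwo.add_self_eq_zero, add_zero]
      refine (contract_ι_mul f e x).symm ▸ sub_mem (Submodule.smul_mem _ _ ?_) ?_
      · rw [h2]
        exact Submodule.mem_iSup_of_mem (p := fun j : { n : ℕ // (n : ZMod 2) = i } =>
          LinearMap.range (CliffordAlgebra.ι (0 : QuadraticForm ℂ (Evec N))) ^ (j : ℕ))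
          ⟨i, rfl⟩ hx
      · convert ι_mul_mem_evenOdd e ih using 2
        push_cast
        ring
  have hle : evenOdd (0 : QuadraticForm ℂ (Evec N)) i ≤
      (evenOdd (0 : QuadraticForm ℂ (Evec N)) (i + 1)).comap (contract f) := by
    refine iSup_le ?_
    rintro ⟨n, rfl⟩ y hy
    exact key n y hy
  exact hle hx

lemma cliff_mem_evenOdd {N : ℕ} (v : Vsp N) {i : ZMod 2} {x : ExtE N}
    (hx : x ∈ evenOdd (0 : QuadraticForm ℂ (Evec N)) i) :
    cliff v x ∈ evenOdd (0 : QuadraticForm ℂ (Evec N)) (i + 1) :=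
  add_mem (ι_mul_mem_evenOdd _ hx) (contract_mem_evenOdd _ hx)

lemma finrank_extE (N : ℕ) : Module.finrank ℂ (ExtE N) = 2 ^ N := by
  simp [Module.finrank_eq_card_basis (Pi.basisFun ℂ (Fin N)).ExteriorAlgebra]

instance {N : ℕ} : FiniteDimensional ℂ (ExtE N) :=
  Module.Basis.finiteDimensional_of_finite (Pi.basisFun ℂ (Fin N)).ExteriorAlgebra

/-- A family of vectors whose nontrivial combinations are never orthogonal to `W` admits a dual
family in `W`. -/
lemma exists_dual_family {N : ℕ} {ι : Type*} [Fintype ι] [DecidableEq ι] (W : Submodule ℂ (Vsp N))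
    (h : ι → Vsp N)
    (hh : ∀ c : ι → ℂ, (∀ w ∈ W, polarForm (∑ i, c i • h i) w = 0) → c = 0) :
    ∃ g : ι → Vsp N, (∀ i, g i ∈ W) ∧
      ∀ i j, polarForm (h i) (g j) = if i = j then 1 else 0 := by
  let f : W →ₗ[ℂ] (ι → ℂ) := LinearMap.pi fun i => (polarForm (h i)).comp W.subtype
  have hf : Function.Surjective f := by
    rw [← LinearMap.range_eq_top]
    by_contra hne
    obtain ⟨φ, hφ0, hφ⟩ := Submodule.exists_le_ker_of_lt_top _ (lt_top_iff_ne_top.2 hne)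
    have hφc : ∀ x : ι → ℂ, φ x = ∑ i, φ (Pi.single i 1) * x i := by
      intro x
      conv_lhs => rw [pi_eq_sum_univ' x]
      simp only [map_sum, map_smul, smul_eq_mul]
      refine Finset.sum_congr rfl fun i _ => ?_
      rw [mul_comm]
    have := hh (fun i => φ (Pi.single i 1)) fun w hw => by
      have h0 : φ (f ⟨w, hw⟩) = 0 := hφ ⟨_, rfl⟩
      rw [hφc] at h0
      simpa [f] using h0
    exact hφ0 (LinearMap.ext fun x => by rw [hφc]; simp [funext_iff] at this; simp [this])
  choose g hg using fun j => hf (Pi.single j 1)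
  refine ⟨fun j => g j, fun j => (g j).2, fun i j => ?_⟩
  have := congrFun (hg j) i
  simpa [f, Pi.single_apply] using this

lemma polarForm_eq_zero_of_cliff_eq_zero {N : ℕ} {x : ExtE N} (hx : x ≠ 0) {v w : Vsp N}
    (hv : cliff v x = 0) (hw : cliff w x = 0) : polarForm v w = 0 := by
  have h := cliff_add_swap v w x
  rw [hv, hw, map_zero, map_zero, add_zero] at h
  exact (smul_eq_zero.1 h.symm).resolve_right hx

/-- Each of the members of an isotropic family with a dual family halves the dimension of the
space of spinors annihilated. -/
lemma two_pow_mul_finrank_iInf_ker {N : ℕ} {ι : Type*} [DecidableEq ι] (h g : ι → Vsp N)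
    (hh : ∀ i j, polarForm (h i) (h j) = 0)
    (hg : ∀ i j, polarForm (h i) (g j) = if i = j then 1 else 0) (s : Finset ι) :
    2 ^ s.card * Module.finrank ℂ ↥(⨅ i ∈ s, LinearMap.ker (cliff (h i))) = 2 ^ N := by
  induction s using Finset.induction_on with
  | empty =>
    have h0 : (⨅ i ∈ (∅ : Finset ι), LinearMap.ker (cliff (h i))) = ⊤ := by simp
    rw [h0, finrank_top, finrank_extE, Finset.card_empty, pow_zero, one_mul]
  | insert i s his ih =>
    rw [Finset.card_insert_of_notMem his, pow_succ, mul_assoc, ← ih]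
    congr 1
    set K := ⨅ j ∈ s, LinearMap.ker (cliff (h j)) with hK
    have memK : ∀ x, x ∈ K ↔ ∀ j ∈ s, cliff (h j) x = 0 := by simp [hK]
    have hself : ∀ x, cliff (h i) (cliff (h i) x) = 0 := fun x => by
      have := cliff_add_swap (h i) (h i) x
      rw [hh, zero_smul, ← two_smul ℂ] at this
      exact (smul_eq_zero.1 this).resolve_left two_ne_zero
    have hres : ∀ x ∈ K, cliff (h i) x ∈ K := fun x hx => (memK _).2 fun j hj => by
      rw [cliff_comm, hh, (memK x).1 hx j hj]; simp
    have gres : ∀ x ∈ K, cliff (g i) x ∈ K := fun x hx => (memK _).2 fun j hj => by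
      rw [cliff_comm, hg, (memK x).1 hx j hj, if_neg (by rintro rfl; exact his hj)]; simp
    let T : K →ₗ[ℂ] K := (cliff (h i)).restrict hres
    have hT : LinearMap.range T = LinearMap.ker T := by
      ext x
      constructor
      · rintro ⟨y, rfl⟩
        exact Subtype.ext (hself y)
      · intro hx
        have hx' : cliff (h i) (x : ExtE N) = 0 := congrArg Subtype.val hx
        refine ⟨⟨cliff (g i) x, gres x x.2⟩, Subtype.ext ?_⟩
        change cliff (h i) (cliff (g i) x) = x
        rw [cliff_comm, hg, hx']
        simp
    have hker : (LinearMap.ker T).map K.subtype =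
        ⨅ j ∈ insert i s, LinearMap.ker (cliff (h j)) := by
      ext x
      rw [Finset.iInf_insert, ← hK, Submodule.mem_inf]
      constructor
      · rintro ⟨y, hy, rfl⟩
        exact ⟨congrArg Subtype.val hy, y.2⟩
      · rintro ⟨hx, hxK⟩
        exact ⟨⟨x, hxK⟩, Subtype.ext hx, rfl⟩
    rw [← hker, Submodule.finrank_map_subtype_eq]
    have := LinearMap.finrank_range_add_finrank_ker T
    rw [hT] at this
    omega

/-- The spinors annihilated by the subspace `H`. -/
def annSpinors {N : ℕ} (H : Submodule ℂ (Vsp N)) : Submodule ℂ (ExtE N) :=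
  ⨅ v : H, LinearMap.ker (cliff (v : Vsp N))

lemma mem_annSpinors {N : ℕ} {H : Submodule ℂ (Vsp N)} {x : ExtE N} :
    x ∈ annSpinors H ↔ ∀ v ∈ H, cliff v x = 0 := by
  simp [annSpinors]

lemma two_pow_mul_finrank_annSpinors {N : ℕ} {H : Submodule ℂ (Vsp N)}
    (hH : ∀ v ∈ H, ∀ w ∈ H, polarForm v w = 0) :
    2 ^ Module.finrank ℂ H * Module.finrank ℂ (annSpinors H) = 2 ^ N := by
  classical
  let b := Module.finBasis ℂ H
  have hb : LinearIndependent ℂ fun i => (b i : Vsp N) :=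
    b.linearIndependent.map' H.subtype (Submodule.ker_subtype H)
  obtain ⟨g, -, hg⟩ := exists_dual_family ⊤ (fun i => (b i : Vsp N)) fun c hc =>
    funext (Fintype.linearIndependent_iff.1 hb c
      (polarForm_eq_zero fun w => hc w Submodule.mem_top))
  have key := two_pow_mul_finrank_iInf_ker (fun i => (b i : Vsp N)) g
    (fun i j => hH _ (b i).2 _ (b j).2) hg Finset.univ
  have heq : (⨅ i ∈ Finset.univ, LinearMap.ker (cliff (b i : Vsp N))) = annSpinors H := by
    ext x
    simp only [Finset.mem_univ, iInf_true, Submodule.mem_iInf, LinearMap.mem_ker, mem_annSpinors]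
    refine ⟨fun h v hv => ?_, fun h i => h _ (b i).2⟩
    have hsum := congrArg Subtype.val (b.sum_repr ⟨v, hv⟩)
    simp only [Submodule.coe_sum, Submodule.coe_smul] at hsum
    rw [← hsum]
    simp [h]
  rw [heq] at key
  simpa using key

lemma finrank_ker_psi_le {N : ℕ} {x : ExtE N} (hx : x ≠ 0) :
    Module.finrank ℂ (LinearMap.ker (psi x)) ≤ N := by
  have key := two_pow_mul_finrank_annSpinors (H := LinearMap.ker (psi x))
    fun v hv w hw => polarForm_eq_zero_of_cliff_eq_zero hx hv hw
  exact (Nat.pow_dvd_pow_iff_le_right (by norm_num)).1 ⟨_, key.symm⟩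

lemma exists_eq_smul_of_ker_le {N : ℕ} {a x : ExtE N} (ha : purespinor a)
    (hx : ∀ v, cliff v a = 0 → cliff v x = 0) : ∃ c : ℂ, x = c • a := by
  have key := two_pow_mul_finrank_annSpinors (H := LinearMap.ker (psi a))
    fun v hv w hw => polarForm_eq_zero_of_cliff_eq_zero ha.1 hv hw
  rw [ha.2.2] at key
  have h1 : Module.finrank ℂ (annSpinors (LinearMap.ker (psi a))) = 1 :=
    Nat.eq_of_mul_eq_mul_left (pow_pos two_pos N) (key.trans (mul_one _).symm)
  have haA : a ∈ annSpinors (LinearMap.ker (psi a)) := mem_annSpinors.2 fun v hv => hv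
  have hxA : x ∈ annSpinors (LinearMap.ker (psi a)) := mem_annSpinors.2 hx
  obtain ⟨c, hc⟩ := (finrank_eq_one_iff_of_nonzero' (⟨a, haA⟩ : annSpinors _)
    (fun h => ha.1 (congrArg Subtype.val h))).1 h1 ⟨x, hxA⟩
  exact ⟨c, (congrArg Subtype.val hc).symm⟩

lemma eq_zero_of_mem_even_of_mem_odd {N : ℕ} {x : ExtE N} (h0 : x ∈ evenPart N)
    (h1 : x ∈ oddPart N) : x = 0 :=
  Submodule.disjoint_def.1 (evenOdd_isCompl (0 : QuadraticForm ℂ (Evec N))).disjoint x h0 h1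

/-- The annihilator of a pure spinor is its own orthogonal complement. -/
lemma cliff_eq_zero_of_forall_polarForm {N : ℕ} {a : ExtE N} (ha : purespinor a) {v : Vsp N}
    (hv : ∀ w, cliff w a = 0 → polarForm w v = 0) : cliff v a = 0 := by
  obtain ⟨c, hc⟩ := exists_eq_smul_of_ker_le (x := cliff v a) ha fun w hw => by
    rw [cliff_comm, hv w hw, hw, zero_smul, map_zero, sub_zero]
  refine eq_zero_of_mem_even_of_mem_odd (hc ▸ Submodule.smul_mem _ _ ha.2.1) ?_
  have hodd := cliff_mem_evenOdd v ha.2.1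
  rw [zero_add] at hodd
  exact hodd

/-- The spinors killed by all products of `n` vectors in `P`. -/
def killed {N : ℕ} (P : Set (Vsp N)) : ℕ → Submodule ℂ (ExtE N)
  | 0 => ⊥
  | n + 1 => ⨅ v ∈ P, (killed P n).comap (cliff v)

lemma mem_killed_succ {N : ℕ} {P : Set (Vsp N)} {n : ℕ} {x : ExtE N} :
    x ∈ killed P (n + 1) ↔ ∀ v ∈ P, cliff v x ∈ killed P n := by
  simp [killed]

lemma killed_anti {N : ℕ} {P Q : Set (Vsp N)} (h : P ⊆ Q) (n : ℕ) : killed Q n ≤ killed P n := by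
  induction n with
  | zero => exact le_rfl
  | succ n ih =>
    intro x hx
    exact mem_killed_succ.2 fun v hv => ih (mem_killed_succ.1 hx v (h hv))

lemma killed_le_succ {N : ℕ} (P : Set (Vsp N)) (n : ℕ) : killed P n ≤ killed P (n + 1) := by
  induction n with
  | zero => exact bot_le
  | succ n ih =>
    intro x hx
    exact mem_killed_succ.2 fun v hv => ih (mem_killed_succ.1 hx v hv)

lemma cliff_mem_killed_succ {N : ℕ} {P : Set (Vsp N)} (w : Vsp N) {n : ℕ} {x : ExtE N}
    (hx : x ∈ killed P n) : cliff w x ∈ killed P (n + 1) := by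
  induction n generalizing x with
  | zero =>
    rw [(Submodule.mem_bot ℂ).1 hx, map_zero]
    exact zero_mem _
  | succ n ih =>
    refine mem_killed_succ.2 fun v hv => ?_
    rw [cliff_comm]
    exact sub_mem (Submodule.smul_mem _ _ hx) (ih (mem_killed_succ.1 hx v hv))

lemma cliff_mem_killed_of_orthogonal {N : ℕ} {P : Set (Vsp N)} {w : Vsp N}
    (hw : ∀ v ∈ P, polarForm v w = 0) {n : ℕ} {x : ExtE N}
    (hx : x ∈ killed P n) : cliff w x ∈ killed P n := by
  induction n generalizing x with
  | zero =>
    rw [(Submodule.mem_bot ℂ).1 hx, map_zero]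
    exact zero_mem _
  | succ n ih =>
    refine mem_killed_succ.2 fun v hv => ?_
    rw [cliff_comm, hw v hv, zero_smul, zero_sub]
    exact neg_mem (ih (mem_killed_succ.1 hx v hv))

/-- A spinor killed by all products of `p` of the `hᵢ` and all products of `q` of the dual
vectors `gᵢ` vanishes as soon as `p + q` is at most one more than the number of pairs. -/
lemma eq_zero_of_mem_killed {N : ℕ} {ι : Type*} [DecidableEq ι] {h g : ι → Vsp N}
    (hhg : ∀ i j, polarForm (h i) (g j) = if i = j then 1 else 0) (s : Finset ι) :
    ∀ (p q : ℕ) (x : ExtE N), x ∈ killed (h '' s) p → x ∈ killed (g '' s) q →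
      p + q ≤ s.card + 1 → x = 0 := by
  induction s using Finset.induction_on with
  | empty =>
    intro p q x hp hq hpq
    rcases p with _ | p
    · exact (Submodule.mem_bot ℂ).1 hp
    · obtain rfl : q = 0 := by simp at hpq; omega
      exact (Submodule.mem_bot ℂ).1 hq
  | insert i s his ih =>
    intro p q x hp hq hpq
    rcases p with _ | p
    · exact (Submodule.mem_bot ℂ).1 hp
    rcases q with _ | q
    · exact (Submodule.mem_bot ℂ).1 hq
    rw [Finset.card_insert_of_notMem his] at hpq
    have hsub : ∀ f : ι → Vsp N, f '' s ⊆ f '' ↑(insert i s) := fun f =>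
      Set.image_mono (by simp)
    have hmem : ∀ f : ι → Vsp N, f i ∈ f '' ↑(insert i s) := fun f => ⟨i, by simp, rfl⟩
    have h1 : cliff (h i) x = 0 := by
      refine ih p (q + 1) _ (killed_anti (hsub h) _ (mem_killed_succ.1 hp _ (hmem h))) ?_ (by omega)
      refine cliff_mem_killed_of_orthogonal ?_ (killed_anti (hsub g) _ hq)
      rintro _ ⟨j, hj, rfl⟩
      rw [polarForm_comm, hhg, if_neg (by rintro rfl; exact his hj)]
    have h2 : cliff (g i) x = 0 := by
      refine ih (p + 1) q _ ?_ (killed_anti (hsub g) _ (mem_killed_succ.1 hq _ (hmem g))) (by omega)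
      refine cliff_mem_killed_of_orthogonal ?_ (killed_anti (hsub h) _ hp)
      rintro _ ⟨j, hj, rfl⟩
      rw [hhg, if_neg (by rintro rfl; exact his hj)]
    have := cliff_add_swap (h i) (g i) x
    rw [h1, h2, map_zero, map_zero, add_zero, hhg, if_pos rfl, one_smul] at this
    exact this.symm

lemma exists_family_spanning_complement {K V : Type*} [Field K] [AddCommGroup V] [Module K V]
    [FiniteDimensional K V] {D H : Submodule K V} (hDH : D ≤ H) :
    ∃ (k : ℕ) (h : Fin k → V), k + Module.finrank K D = Module.finrank K H ∧ (∀ i, h i ∈ H) ∧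
      (∀ c : Fin k → K, ∑ i, c i • h i ∈ D → c = 0) ∧
      ∀ w ∈ H, ∃ c : Fin k → K, w - ∑ i, c i • h i ∈ D := by
  obtain ⟨C', hC'⟩ := D.exists_isCompl
  set C := C' ⊓ H with hC
  have hsup : D ⊔ C = H := by
    rw [hC, ← sup_inf_assoc_of_le C' hDH, hC'.sup_eq_top, top_inf_eq]
  have hinf : D ⊓ C = ⊥ := by
    rw [eq_bot_iff, ← hC'.inf_eq_bot]
    exact inf_le_inf_left D inf_le_left
  let β := Module.finBasis K C
  have hsum : ∀ c : Fin (Module.finrank K C) → K,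
      ∑ i, c i • (β i : V) = ((∑ i, c i • β i : C) : V) := fun c => by simp
  refine ⟨_, fun i => (β i : V), ?_, fun i => (β i).2.2, fun c hc => ?_, fun w hw => ?_⟩
  · have := Submodule.finrank_sup_add_finrank_inf_eq D C
    rw [hsup, hinf, finrank_bot] at this
    omega
  · rw [hsum] at hc
    have h0 : ((∑ i, c i • β i : C) : V) ∈ D ⊓ C := ⟨hc, (∑ i, c i • β i : C).2⟩
    rw [hinf, Submodule.mem_bot] at h0
    exact funext (Fintype.linearIndependent_iff.1 β.linearIndependent c (Subtype.ext h0))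
  · rw [← hsup] at hw
    obtain ⟨d, hd, e, he, rfl⟩ := Submodule.mem_sup.1 hw
    refine ⟨β.repr ⟨e, he⟩, ?_⟩
    rw [hsum, β.sum_repr, add_sub_cancel_right]
    exact hd

/-- The annihilators of two pure spinors contain dual families which span complements to their
intersection. -/
lemma exists_dual_families {N : ℕ} {a b : ExtE N} (ha : purespinor a) (hb : purespinor b) :
    ∃ (k : ℕ) (h g : Fin k → Vsp N),
      k + Module.finrank ℂ ↥(LinearMap.ker (psi a) ⊓ LinearMap.ker (psi b)) = N ∧
      (∀ i, cliff (h i) a = 0) ∧ (∀ i, cliff (g i) b = 0) ∧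
      (∀ i j, polarForm (h i) (g j) = if i = j then 1 else 0) ∧
      ∀ v, cliff v b = 0 → ∃ c : Fin k → ℂ, cliff (v - ∑ i, c i • g i) a = 0 := by
  obtain ⟨k, h, hk, hha, hind, hspan⟩ := exists_family_spanning_complement
    (inf_le_left : LinearMap.ker (psi a) ⊓ LinearMap.ker (psi b) ≤ LinearMap.ker (psi a))
  obtain ⟨g, hgb, hg⟩ := exists_dual_family (LinearMap.ker (psi b)) h fun c hc =>
    hind c ⟨Submodule.sum_mem _ fun i _ => Submodule.smul_mem _ _ (hha i),
      cliff_eq_zero_of_forall_polarForm hb fun w hw => by rw [polarForm_comm]; exact hc w hw⟩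
  refine ⟨k, h, g, hk.trans ha.2.2, hha, hgb, hg, fun v hv => ⟨fun i => polarForm (h i) v, ?_⟩⟩
  have hdb : v - ∑ i, polarForm (h i) v • g i ∈ LinearMap.ker (psi b) :=
    sub_mem hv (Submodule.sum_mem _ fun i _ => Submodule.smul_mem _ _ (hgb i))
  refine cliff_eq_zero_of_forall_polarForm ha fun w hw => ?_
  obtain ⟨c, hc⟩ := hspan w hw
  have hd0 : polarForm (w - ∑ i, c i • h i) (v - ∑ i, polarForm (h i) v • g i) = 0 :=
    polarForm_eq_zero_of_cliff_eq_zero hb.1 hc.2 hdb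
  rw [map_sub polarForm, LinearMap.sub_apply, sub_eq_zero] at hd0
  rw [hd0, map_sum, LinearMap.sum_apply]
  refine Finset.sum_eq_zero fun i _ => ?_
  simp [hg]

lemma cliff_cliff_self {N : ℕ} {v : Vsp N} (hv : polarForm v v = 0) (x : ExtE N) :
    cliff v (cliff v x) = 0 := by
  have h := cliff_add_swap v v x
  rw [hv, zero_smul, ← two_smul ℂ] at h
  exact (smul_eq_zero.1 h).resolve_left two_ne_zero

lemma finrank_ker_psi_eq_of_injective {N : ℕ} {y z : ExtE N} (hz : z ≠ 0)
    (hy : Module.finrank ℂ (LinearMap.ker (psi y)) = N) (φ : Vsp N →ₗ[ℂ] Vsp N)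
    (hφ : ∀ v, φ v = 0 → v = 0) (hφz : ∀ v, cliff v y = 0 → cliff (φ v) z = 0) :
    Module.finrank ℂ (LinearMap.ker (psi z)) = N := by
  refine le_antisymm (finrank_ker_psi_le hz) ?_
  conv_lhs => rw [← hy]
  exact LinearMap.finrank_le_finrank_of_injective
    (f := φ.restrict (p := LinearMap.ker (psi y)) (q := LinearMap.ker (psi z)) hφz)
    ((injective_iff_map_eq_zero _).2 fun v hv => Subtype.ext (hφ v (congrArg Subtype.val hv)))

lemma finrank_ker_psi_cliff {N : ℕ} {y : ExtE N} {g h : Vsp N}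
    (hy : Module.finrank ℂ (LinearMap.ker (psi y)) = N) (hgy : cliff g y ≠ 0)
    (hhy : cliff h y = 0) (hh : polarForm h h = 0) (hg : polarForm g g = 0)
    (hhg : polarForm h g = 1) :
    Module.finrank ℂ (LinearMap.ker (psi (cliff g y))) = N := by
  set u := g + h with hu
  have huu : polarForm u u = 2 := by
    simp only [hu, map_add, LinearMap.add_apply, hh, hg, hhg, polarForm_comm g h]
    norm_num
  have huy : cliff u y = cliff g y := by
    rw [hu, map_add, LinearMap.add_apply, hhy, add_zero]
  have huuy : cliff u (cliff u y) = y := by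
    have := cliff_add_swap u u y
    rw [huu, ← two_smul ℂ] at this
    exact smul_right_injective _ (two_ne_zero (α := ℂ)) this
  refine finrank_ker_psi_eq_of_injective hgy hy
    ((polarForm u).smulRight u - LinearMap.id) (fun v hv => ?_) fun v hv => ?_
  · have hv' : polarForm u v • u - v = 0 := hv
    have h0 := congrArg (polarForm u) hv'
    rw [map_sub, map_smul, huu, map_zero, smul_eq_mul] at h0
    have h1 : polarForm u v = 0 := by linear_combination h0
    rw [h1, zero_smul, zero_sub, neg_eq_zero] at hv'
    exact hv'
  · change cliff (polarForm u v • u - v) (cliff g y) = 0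
    rw [← huy, map_sub, LinearMap.sub_apply, map_smul, LinearMap.smul_apply, huuy, cliff_comm v u,
      hv, map_zero, sub_zero, polarForm_comm v u, sub_self]

lemma finrank_ker_psi_smul_add {N : ℕ} {y : ExtE N} {g₀ g₁ : Vsp N} {s t : ℂ} (hs : s ≠ 0)
    (hy : Module.finrank ℂ (LinearMap.ker (psi y)) = N)
    (hz : s • y + t • cliff g₁ (cliff g₀ y) ≠ 0) (h00 : polarForm g₀ g₀ = 0)
    (h01 : polarForm g₀ g₁ = 0) (h11 : polarForm g₁ g₁ = 0) :
    Module.finrank ℂ (LinearMap.ker (psi (s • y + t • cliff g₁ (cliff g₀ y)))) = N := by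
  have h10 : polarForm g₁ g₀ = 0 := by rw [polarForm_comm, h01]
  refine finrank_ker_psi_eq_of_injective hz hy
    (LinearMap.id - (t / s) • ((polarForm g₁).smulRight g₀ - (polarForm g₀).smulRight g₁))
    (fun v hv => ?_) fun v hv => ?_
  · have hv' : v - (t / s) • (polarForm g₁ v • g₀ - polarForm g₀ v • g₁) = 0 := hv
    have e0 := congrArg (polarForm g₀) hv'
    have e1 := congrArg (polarForm g₁) hv'
    simp only [map_sub, map_smul, h00, h01, h10, h11, smul_zero, sub_zero, map_zero] at e0 e1
    simpa [e0, e1] using hv'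
  · change cliff (v - (t / s) • (polarForm g₁ v • g₀ - polarForm g₀ v • g₁)) _ = 0
    have z0 : cliff g₀ (cliff g₁ (cliff g₀ y)) = 0 := by
      rw [cliff_comm, h01, cliff_cliff_self h00, zero_smul, map_zero, sub_zero]
    have z1 : cliff g₁ (cliff g₁ (cliff g₀ y)) = 0 := cliff_cliff_self h11 _
    have zv : cliff v (cliff g₁ (cliff g₀ y)) =
        polarForm g₁ v • cliff g₀ y - polarForm g₀ v • cliff g₁ y := by
      rw [cliff_comm v g₁, cliff_comm v g₀, hv, map_zero, sub_zero, map_smul,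
        polarForm_comm v g₁, polarForm_comm v g₀]
    simp only [map_sub, map_add, map_smul, LinearMap.sub_apply, LinearMap.smul_apply, hv, zv, z0,
      z1, smul_zero, sub_zero]
    have hts : t = (t / s) * s := by field_simp
    generalize t / s = r at hts
    subst hts
    module

lemma purespinor_smul {N : ℕ} {a : ExtE N} (ha : purespinor a) {c : ℂ} (hc : c ≠ 0) :
    purespinor (c • a) := by
  refine ⟨smul_ne_zero hc ha.1, Submodule.smul_mem _ _ ha.2.1, ?_⟩
  have hker : LinearMap.ker (psi (c • a)) = LinearMap.ker (psi a) := by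
    ext v
    rw [mem_ker_psi, mem_ker_psi, map_smul, smul_eq_zero_iff_right hc]
  rw [hker, ha.2.2]

lemma mk_mem_spinorVariety {N : ℕ} {z : ExtE N} (hz : z ≠ 0) :
    Projectivization.mk ℂ z hz ∈ SpinorVariety N ↔ purespinor z := by
  refine ⟨?_, fun h => ⟨z, hz, h, rfl⟩⟩
  rintro ⟨a, ha, hpa, h⟩
  obtain ⟨c, hc⟩ := (Projectivization.mk_eq_mk_iff' ℂ _ _ hz ha).1 h
  rw [← hc]
  exact purespinor_smul hpa (by rintro rfl; exact hz (by rw [← hc, zero_smul]))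

lemma lineIn_mk_iff {K V : Type*} [DivisionRing K] [AddCommGroup V] [Module K V]
    {X : Set (Projectivization K V)} {x y : V} (hx : x ≠ 0) (hy : y ≠ 0) :
    lineIn X (Projectivization.mk K x hx) (Projectivization.mk K y hy) ↔
      ∀ (s t : K) (hz : s • x + t • y ≠ 0), Projectivization.mk K (s • x + t • y) hz ∈ X := by
  constructor
  · intro h s t hz
    refine h _ ?_
    rw [Projectivization.submodule_mk, Submodule.span_singleton_le_iff_mem,
      Projectivization.submodule_mk, Projectivization.submodule_mk]
    exact add_mem
      (Submodule.mem_sup_left (Submodule.smul_mem _ _ (Submodule.mem_span_singleton_self x)))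
      (Submodule.mem_sup_right (Submodule.smul_mem _ _ (Submodule.mem_span_singleton_self y)))
  · intro h r
    induction r using Projectivization.ind with
    | h z hz =>
      intro hr
      rw [Projectivization.submodule_mk, Submodule.span_singleton_le_iff_mem,
        Projectivization.submodule_mk, Projectivization.submodule_mk, Submodule.mem_sup] at hr
      obtain ⟨_, h1, _, h2, rfl⟩ := hr
      obtain ⟨s, rfl⟩ := Submodule.mem_span_singleton.1 h1
      obtain ⟨t, rfl⟩ := Submodule.mem_span_singleton.1 h2
      exact h s t hz

/-- The spinors obtained from `a` by successive Clifford multiplication by `g 0, g 1, …`. -/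
def spinorSeq {N : ℕ} (a : ExtE N) (g : ℕ → Vsp N) : ℕ → ExtE N
  | 0 => a
  | n + 1 => cliff (g n) (spinorSeq a g n)

section spinorSeq

variable {N : ℕ} {a : ExtE N} {g h : ℕ → Vsp N} {k : ℕ}

lemma cliff_spinorSeq_eq_zero {d : Vsp N} (hda : cliff d a = 0) {n : ℕ}
    (hdg : ∀ i < n, polarForm d (g i) = 0) : cliff d (spinorSeq a g n) = 0 := by
  induction n with
  | zero => exact hda
  | succ n ih =>
    rw [spinorSeq, cliff_comm, hdg n (Nat.lt_succ_self n),
      ih fun i hi => hdg i (Nat.lt_succ_of_lt hi), zero_smul, map_zero, sub_zero]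

lemma cliff_spinorSeq_eq_zero_of_lt (hgg : ∀ i j, polarForm (g i) (g j) = 0) {i n : ℕ}
    (hin : i < n) : cliff (g i) (spinorSeq a g n) = 0 := by
  induction n with
  | zero => omega
  | succ n ih =>
    rw [spinorSeq]
    rcases Nat.lt_succ_iff_lt_or_eq.1 hin with hlt | rfl
    · rw [cliff_comm, hgg, ih hlt, zero_smul, map_zero, sub_zero]
    · exact cliff_cliff_self (hgg i i) _

lemma cliff_spinorSeq_succ (hha : ∀ i < k, cliff (h i) a = 0)
    (hhg : ∀ i < k, ∀ j < k, polarForm (h i) (g j) = if i = j then 1 else 0) {n : ℕ}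
    (hn : n < k) : cliff (h n) (spinorSeq a g (n + 1)) = spinorSeq a g n := by
  have h0 : cliff (h n) (spinorSeq a g n) = 0 := cliff_spinorSeq_eq_zero (hha n hn) fun i hi => by
    rw [hhg n hn i (hi.trans hn), if_neg hi.ne']
  rw [spinorSeq, cliff_comm, hhg n hn n hn, if_pos rfl, h0, map_zero, sub_zero, one_smul]

lemma spinorSeq_ne_zero (ha : a ≠ 0) (hha : ∀ i < k, cliff (h i) a = 0)
    (hhg : ∀ i < k, ∀ j < k, polarForm (h i) (g j) = if i = j then 1 else 0) {n : ℕ}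
    (hn : n ≤ k) : spinorSeq a g n ≠ 0 := by
  induction n with
  | zero => exact ha
  | succ n ih =>
    intro h0
    apply ih (by omega)
    rw [← cliff_spinorSeq_succ hha hhg hn, h0, map_zero]

lemma spinorSeq_mem_evenOdd (ha : a ∈ evenPart N) (n : ℕ) :
    spinorSeq a g n ∈ evenOdd (0 : QuadraticForm ℂ (Evec N)) n := by
  induction n with
  | zero =>
    rw [Nat.cast_zero]
    exact ha
  | succ n ih =>
    rw [Nat.cast_succ]
    exact cliff_mem_evenOdd _ ih

lemma finrank_ker_psi_spinorSeq (ha : purespinor a) (hgg : ∀ i j, polarForm (g i) (g j) = 0)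
    (hha : ∀ i < k, cliff (h i) a = 0)
    (hhg : ∀ i < k, ∀ j < k, polarForm (h i) (g j) = if i = j then 1 else 0) {n : ℕ}
    (hn : n ≤ k) : Module.finrank ℂ (LinearMap.ker (psi (spinorSeq a g n))) = N := by
  induction n with
  | zero => exact ha.2.2
  | succ n ih =>
    refine finrank_ker_psi_cliff (ih (by omega)) (spinorSeq_ne_zero ha.1 hha hhg hn)
      (cliff_spinorSeq_eq_zero (hha n hn) fun i hi => ?_)
      (polarForm_eq_zero_of_cliff_eq_zero ha.1 (hha n hn) (hha n hn)) (hgg n n) ?_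
    · rw [hhg n hn i (hi.trans hn), if_neg hi.ne']
    · rw [hhg n hn n hn, if_pos rfl]

lemma purespinor_spinorSeq (ha : purespinor a) (hgg : ∀ i j, polarForm (g i) (g j) = 0)
    (hha : ∀ i < k, cliff (h i) a = 0)
    (hhg : ∀ i < k, ∀ j < k, polarForm (h i) (g j) = if i = j then 1 else 0) {n : ℕ}
    (hn : n ≤ k) (heven : Even n) : purespinor (spinorSeq a g n) := by
  refine ⟨spinorSeq_ne_zero ha.1 hha hhg hn, ?_, finrank_ker_psi_spinorSeq ha hgg hha hhg hn⟩
  have := spinorSeq_mem_evenOdd (g := g) ha.2.1 n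
  rwa [(ZMod.natCast_eq_zero_iff_even).2 heven] at this

end spinorSeq

lemma lineIn_cliff_cliff {N : ℕ} {y : ExtE N} {g₀ g₁ : Vsp N} (hy : purespinor y)
    (hy' : purespinor (cliff g₁ (cliff g₀ y))) (h00 : polarForm g₀ g₀ = 0)
    (h01 : polarForm g₀ g₁ = 0) (h11 : polarForm g₁ g₁ = 0) :
    lineIn (SpinorVariety N) (Projectivization.mk ℂ y hy.1) (Projectivization.mk ℂ _ hy'.1) := by
  rw [lineIn_mk_iff]
  intro s t hz
  rw [mk_mem_spinorVariety]
  rcases eq_or_ne s 0 with rfl | hs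
  · have ht : t ≠ 0 := by rintro rfl; simp at hz
    rw [zero_smul, zero_add]
    exact purespinor_smul hy' ht
  · exact ⟨hz, add_mem (Submodule.smul_mem _ _ hy.2.1) (Submodule.smul_mem _ _ hy'.2.1),
      finrank_ker_psi_smul_add hs hy.2.2 hz h00 h01 h11⟩

/-- Up to a scalar, any two pure spinors of the same parity are joined by Clifford multiplication by
an even number of isotropic vectors, namely the codimension of the intersection of their
annihilators. -/
lemma exists_spinorSeq_eq_smul {N : ℕ} {a b : ExtE N} (ha : purespinor a) (hb : purespinor b) :
    ∃ (m : ℕ) (h g : ℕ → Vsp N),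
      2 * m + Module.finrank ℂ ↥(LinearMap.ker (psi a) ⊓ LinearMap.ker (psi b)) = N ∧
      (∀ i < 2 * m, cliff (h i) a = 0) ∧ (∀ i j, polarForm (g i) (g j) = 0) ∧
      (∀ i < 2 * m, ∀ j < 2 * m, polarForm (h i) (g j) = if i = j then 1 else 0) ∧
      ∃ c : ℂ, c ≠ 0 ∧ spinorSeq a g (2 * m) = c • b := by
  obtain ⟨k, h, g, hk, hha, hgb, hhg, hspan⟩ := exists_dual_families ha hb
  let h' : ℕ → Vsp N := fun i => if hi : i < k then h ⟨i, hi⟩ else 0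
  let g' : ℕ → Vsp N := fun i => if hi : i < k then g ⟨i, hi⟩ else 0
  have hha' : ∀ i < k, cliff (h' i) a = 0 := fun i hi => by
    simp only [h', dif_pos hi, hha]
  have hgb' : ∀ i, cliff (g' i) b = 0 := fun i => by
    by_cases hi : i < k
    · simp only [g', dif_pos hi, hgb]
    · simp only [g', dif_neg hi, map_zero, LinearMap.zero_apply]
  have hgg' : ∀ i j, polarForm (g' i) (g' j) = 0 := fun i j =>
    polarForm_eq_zero_of_cliff_eq_zero hb.1 (hgb' i) (hgb' j)
  have hhg' : ∀ i < k, ∀ j < k, polarForm (h' i) (g' j) = if i = j then 1 else 0 :=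
    fun i hi j hj => by simp only [h', g', dif_pos hi, dif_pos hj, hhg, Fin.mk.injEq]
  have hne : spinorSeq a g' k ≠ 0 := spinorSeq_ne_zero ha.1 hha' hhg' le_rfl
  have hkill : ∀ v, cliff v b = 0 → cliff v (spinorSeq a g' k) = 0 := by
    intro v hv
    obtain ⟨c, hc⟩ := hspan v hv
    have hd : cliff (v - ∑ i, c i • g i) (spinorSeq a g' k) = 0 :=
      cliff_spinorSeq_eq_zero hc fun i _ =>
        polarForm_eq_zero_of_cliff_eq_zero hb.1 (by simp [hv, hgb]) (hgb' i)
    have hg0 : ∀ i, cliff (g i) (spinorSeq a g' k) = 0 := fun i => by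
      have := cliff_spinorSeq_eq_zero_of_lt (a := a) hgg' i.2
      simpa only [g', dif_pos i.2, Fin.eta] using this
    simpa [hg0] using hd
  obtain ⟨c, hc⟩ := exists_eq_smul_of_ker_le hb hkill
  have hc0 : c ≠ 0 := by
    rintro rfl
    exact hne (by rw [hc, zero_smul])
  have heven : Even k := by
    by_contra hodd
    have hmem := spinorSeq_mem_evenOdd (g := g') ha.2.1 k
    rw [(ZMod.natCast_eq_one_iff_odd).2 (Nat.not_even_iff_odd.1 hodd)] at hmem
    exact hne (eq_zero_of_mem_even_of_mem_odd (hc ▸ Submodule.smul_mem _ _ hb.2.1) hmem)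
  obtain ⟨m, rfl⟩ := heven.exists_two_nsmul k
  exact ⟨m, h', g', hk, hha', hgg', hhg', c, hc0, hc⟩

lemma chainDist_spinorSeq {N : ℕ} {a : ExtE N} {h g : ℕ → Vsp N} {m : ℕ} (ha : purespinor a)
    (hgg : ∀ i j, polarForm (g i) (g j) = 0) (hha : ∀ i < 2 * m, cliff (h i) a = 0)
    (hhg : ∀ i < 2 * m, ∀ j < 2 * m, polarForm (h i) (g j) = if i = j then 1 else 0)
    (hm : spinorSeq a g (2 * m) ≠ 0) :
    chainDist (SpinorVariety N) (Projectivization.mk ℂ a ha.1)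
      (Projectivization.mk ℂ (spinorSeq a g (2 * m)) hm) m := by
  have hpure : ∀ i ≤ m, purespinor (spinorSeq a g (2 * i)) := fun i hi =>
    purespinor_spinorSeq ha hgg hha hhg (by omega) (even_two_mul i)
  refine ⟨fun i => if hi : i ≤ m then Projectivization.mk ℂ _ (hpure i hi).1 else
    Projectivization.mk ℂ a ha.1, ?_, ?_, fun i hi => ?_, fun i hi => ?_⟩
  · simp only [dif_pos (Nat.zero_le m)]
    rfl
  · simp only [dif_pos (le_refl m)]
  · simp only [dif_pos hi]
    exact (mk_mem_spinorVariety _).2 (hpure i hi)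
  · have hi1 : i + 1 ≤ m := hi
    simp only [dif_pos hi.le, dif_pos hi1]
    exact lineIn_cliff_cliff (hpure i hi.le) (hpure (i + 1) hi1) (hgg _ _) (hgg _ _) (hgg _ _)

lemma self_mem_tangentSpace {N : ℕ} (a : ExtE N) : a ∈ tangentSpace a :=
  Submodule.subset_span (Or.inl rfl)

lemma cliff_cliff_mem_tangentSpace {N : ℕ} (v w : Vsp N) (a : ExtE N) :
    cliff v (cliff w a) ∈ tangentSpace a :=
  Submodule.subset_span (Or.inr ⟨v, w, rfl⟩)

lemma tangentSpace_le_killed {N : ℕ} {a : ExtE N} {P : Set (Vsp N)}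
    (hP : ∀ v ∈ P, cliff v a = 0) : tangentSpace a ≤ killed P 3 := by
  have ha : a ∈ killed P 1 := mem_killed_succ.2 fun v hv => (Submodule.mem_bot ℂ).2 (hP v hv)
  refine Submodule.span_le.2 ?_
  rintro x (rfl | ⟨v, w, rfl⟩)
  · exact killed_le_succ _ _ (killed_le_succ _ _ ha)
  · exact cliff_mem_killed_succ v (cliff_mem_killed_succ w ha)

/-- If two tangent spaces meet, the annihilators intersect in codimension at most `4`. -/
lemma le_finrank_inf_of_tangentSpace_inf_ne_bot {N : ℕ} {a b : ExtE N} (ha : purespinor a)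
    (hb : purespinor b) (hab : tangentSpace a ⊓ tangentSpace b ≠ ⊥) :
    N ≤ Module.finrank ℂ ↥(LinearMap.ker (psi a) ⊓ LinearMap.ker (psi b)) + 4 := by
  obtain ⟨k, h, g, hk, hha, hgb, hhg, -⟩ := exists_dual_families ha hb
  obtain ⟨x, ⟨hxa, hxb⟩, hx⟩ := (Submodule.ne_bot_iff _).1 hab
  by_contra hlt
  refine hx (eq_zero_of_mem_killed hhg Finset.univ 3 3 x (tangentSpace_le_killed ?_ hxa)
    (tangentSpace_le_killed ?_ hxb) ?_)
  · rintro _ ⟨i, -, rfl⟩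
    exact hha i
  · rintro _ ⟨i, -, rfl⟩
    exact hgb i
  · rw [Finset.card_univ, Fintype.card_fin]
    omega

/-- If two pure spinors are joined by a line of pure spinors, their annihilators intersect in
codimension at most `2`. -/
lemma le_finrank_inf_of_lineIn {N : ℕ} {a b : ExtE N} (ha : purespinor a) (hb : purespinor b)
    (hab : lineIn (SpinorVariety N) (Projectivization.mk ℂ a ha.1)
      (Projectivization.mk ℂ b hb.1)) :
    N ≤ Module.finrank ℂ ↥(LinearMap.ker (psi a) ⊓ LinearMap.ker (psi b)) + 2 := by
  rcases eq_or_ne (a + b) 0 with h0 | h0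
  · have hker : LinearMap.ker (psi b) = LinearMap.ker (psi a) := by
      ext v
      rw [mem_ker_psi, mem_ker_psi, eq_neg_of_add_eq_zero_right h0, map_neg, neg_eq_zero]
    rw [hker, inf_idem, ha.2.2]
    omega
  have hs : purespinor (a + b) := by
    have := (lineIn_mk_iff ha.1 hb.1).1 hab 1 1 (by simpa only [one_smul] using h0)
    simpa only [one_smul] using (mk_mem_spinorVariety _).1 this
  obtain ⟨k, h, g, hk, hha, hgb, hhg, -⟩ := exists_dual_families ha hb
  by_contra hlt
  have hle : LinearMap.ker (psi (a + b)) ≤ LinearMap.ker (psi a) ⊓ LinearMap.ker (psi b) := by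
    intro v hv
    have hv' : cliff v a = -cliff v b := by
      rw [mem_ker_psi, map_add] at hv
      exact eq_neg_of_add_eq_zero_left hv
    have hva : cliff v a = 0 := by
      refine eq_zero_of_mem_killed hhg Finset.univ 2 2 _ ?_ ?_ ?_
      · refine cliff_mem_killed_succ v (mem_killed_succ.2 ?_)
        rintro _ ⟨i, -, rfl⟩
        exact (Submodule.mem_bot ℂ).2 (hha i)
      · rw [hv']
        refine neg_mem (cliff_mem_killed_succ v (mem_killed_succ.2 ?_))
        rintro _ ⟨i, -, rfl⟩
        exact (Submodule.mem_bot ℂ).2 (hgb i)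
      · rw [Finset.card_univ, Fintype.card_fin]
        omega
    refine ⟨hva, ?_⟩
    rw [SetLike.mem_coe, mem_ker_psi, ← neg_eq_zero, ← hv', hva]
  have := Submodule.finrank_mono hle
  rw [hs.2.2] at this
  omega

lemma le_finrank_inf_of_chainDist_le_two {N : ℕ} {a b : ExtE N} (ha : purespinor a)
    (hb : purespinor b) {r : ℕ} (hr : r ≤ 2)
    (hab : chainDist (SpinorVariety N) (Projectivization.mk ℂ a ha.1)
      (Projectivization.mk ℂ b hb.1) r) :
    N ≤ Module.finrank ℂ ↥(LinearMap.ker (psi a) ⊓ LinearMap.ker (psi b)) + 4 := by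
  obtain ⟨c, hc0, hcr, hcX, hline⟩ := hab
  have hone : ∀ {x : ExtE N} (hx : purespinor x), lineIn (SpinorVariety N)
      (Projectivization.mk ℂ x hx.1) (Projectivization.mk ℂ x hx.1) := fun {x} hx => by
    intro p hp
    rw [sup_idem] at hp
    induction p using Projectivization.ind with
    | h z hz =>
      rw [Projectivization.submodule_mk, Projectivization.submodule_mk,
        Submodule.span_singleton_le_iff_mem] at hp
      obtain ⟨s, rfl⟩ := Submodule.mem_span_singleton.1 hp
      exact (mk_mem_spinorVariety hz).2 (purespinor_smul hx (by rintro rfl; simp at hz))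
  obtain ⟨q, hqX, haq, hqb⟩ : ∃ q ∈ SpinorVariety N,
      lineIn (SpinorVariety N) (Projectivization.mk ℂ a ha.1) q ∧
      lineIn (SpinorVariety N) q (Projectivization.mk ℂ b hb.1) := by
    interval_cases r
    · rw [hc0] at hcr
      exact ⟨_, (mk_mem_spinorVariety ha.1).2 ha, hone ha, hcr ▸ hone ha⟩
    · refine ⟨_, (mk_mem_spinorVariety hb.1).2 hb, ?_, hone hb⟩
      rw [← hc0, ← hcr]
      exact hline 0 one_pos
    · refine ⟨c 1, hcX 1 one_le_two, ?_, ?_⟩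
      · rw [← hc0]
        exact hline 0 two_pos
      · rw [← hcr]
        exact hline 1 one_lt_two
  obtain ⟨x, hx0, hx, rfl⟩ := hqX
  have h1 := le_finrank_inf_of_lineIn ha hx haq
  have h2 := le_finrank_inf_of_lineIn hx hb hqb
  set A := LinearMap.ker (psi a)
  set B := LinearMap.ker (psi b)
  have h3 := Submodule.finrank_sup_add_finrank_inf_eq (A ⊓ LinearMap.ker (psi x))
    (LinearMap.ker (psi x) ⊓ B)
  have h4 : Module.finrank ℂ ↥(A ⊓ LinearMap.ker (psi x) ⊔ LinearMap.ker (psi x) ⊓ B) ≤ N := by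
    conv_rhs => rw [← hx.2.2]
    exact Submodule.finrank_mono (sup_le inf_le_right inf_le_left)
  have h5 := Submodule.finrank_mono (R := ℂ) (le_inf (inf_le_left.trans inf_le_left)
    (inf_le_right.trans inf_le_right) :
      A ⊓ LinearMap.ker (psi x) ⊓ (LinearMap.ker (psi x) ⊓ B) ≤ A ⊓ B)
  omega

/-- For `N` even, `N ≥ 8`, the second Terracini locus of `S_N^+`
consists of the pairs of pure spinors at Hamming distance at most `2`: the tangent
spaces `T_{[a]} S_N^+` and `T_{[b]} S_N^+` intersect nontrivially if and only if
`d([a],[b]) ≤ 2`. -/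
theorem stmt18 (N : ℕ) (hN : Even N) (h8 : 8 ≤ N)
    (a b : ExtE N) (ha : purespinor a) (hb : purespinor b) :
    tangentSpace a ⊓ tangentSpace b ≠ ⊥ ↔
      hdist (SpinorVariety N) (Projectivization.mk ℂ a ha.1)
        (Projectivization.mk ℂ b hb.1) ≤ 2 := by
  obtain ⟨m, h, g, hk, hha, hgg, hhg, c, hc, hcb⟩ := exists_spinorSeq_eq_smul ha hb
  have hne : ∀ n ≤ 2 * m, spinorSeq a g n ≠ 0 := fun n => spinorSeq_ne_zero ha.1 hha hhg
  have hchain := chainDist_spinorSeq ha hgg hha hhg (hne _ le_rfl)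
  rw [(Projectivization.mk_eq_mk_iff' ℂ _ _ (hne _ le_rfl) hb.1).2 ⟨c, hcb.symm⟩] at hchain
  constructor
  · intro hab
    have := le_finrank_inf_of_tangentSpace_inf_ne_bot ha hb hab
    exact (Nat.sInf_le hchain).trans (by omega)
  · intro hab
    have hk4 := le_finrank_inf_of_chainDist_le_two ha hb hab
      (Nat.sInf_mem (s := {r | chainDist _ _ _ r}) ⟨m, hchain⟩)
    have hback : ∀ n < 2 * m, cliff (h n) (spinorSeq a g (n + 1)) = spinorSeq a g n :=
      fun n => cliff_spinorSeq_succ hha hhg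
    have hm2 : m ≤ 2 := by omega
    refine (Submodule.ne_bot_iff _).2 ?_
    interval_cases m
    · refine ⟨a, ⟨self_mem_tangentSpace a, ?_⟩, ha.1⟩
      have h0 : a = c • b := hcb
      rw [SetLike.mem_coe]
      conv_rhs => rw [h0]
      exact Submodule.smul_mem _ c (self_mem_tangentSpace b)
    · refine ⟨spinorSeq a g 2, ⟨cliff_cliff_mem_tangentSpace _ _ a, ?_⟩, hne 2 le_rfl⟩
      exact (show spinorSeq a g 2 = c • b from hcb) ▸
        Submodule.smul_mem _ c (self_mem_tangentSpace b)
    · refine ⟨spinorSeq a g 2, ⟨cliff_cliff_mem_tangentSpace _ _ a, ?_⟩, hne 2 (by norm_num)⟩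
      have h4 : spinorSeq a g 4 = c • b := hcb
      rw [SetLike.mem_coe, ← hback 2 (by norm_num), ← hback 3 (by norm_num), h4, map_smul, map_smul]
      exact Submodule.smul_mem _ c (cliff_cliff_mem_tangentSpace _ _ b)
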